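/- arXiv:2101.03593 — 4 statements merged into one kernel-verified Lean document; each statement's English description precedes it below -/
import Mathlib

section
/- (Conditional probability is a probability) Let p be a probability function and B a formula with p(B) > 0. Then the function q defined by q(A) = p(A|B) satisfies: (i) 0 ≤ q(A) ≤ 1 for all A; (ii) if A ⊨ C then q(A) ≤ q(C); (iii) q(A∧C) + q(A∨C) = q(A) + q(C) for all A, C; moreover q(B) = 1, and whenever p(C|B) > 0, p(A∧C|B)/p(C|B) = p(A|B∧C). -/
inductive PFormula (α : Type) : Type
  | atom : α → PFormula α
  | neg : PFormula α → PFormula α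
  | conj : PFormula α → PFormula α → PFormula α
  | disj : PFormula α → PFormula α → PFormula α

/-- A Dunn–Belnap valuation: each formula gets a subset of {T, F}. -/
structure DBValuation (α : Type) : Type where
  vT : PFormula α → Prop
  vF : PFormula α → Prop
  negT : ∀ A, vT A.neg ↔ vF A
  negF : ∀ A, vF A.neg ↔ vT A
  conjT : ∀ A B, vT (A.conj B) ↔ (vT A ∧ vT B)
  conjF : ∀ A B, vF (A.conj B) ↔ (vF A ∨ vF B)
  disjT : ∀ A B, vT (A.disj B) ↔ (vT A ∨ vT B)
  disjF : ∀ A B, vF (A.disj B) ↔ (vF A ∧ vF B)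

def Entails {α : Type} (A B : PFormula α) : Prop :=
  ∀ v : DBValuation α, v.vT A → v.vT B

/-- A (generalized) probability function over Dunn–Belnap logic. -/
structure ProbFun (α : Type) : Type where
  p : PFormula α → ℝ
  nonneg : ∀ A, 0 ≤ p A
  le_one : ∀ A, p A ≤ 1
  mono : ∀ A B, Entails A B → p A ≤ p B
  add : ∀ A B, p (A.conj B) + p (A.disj B) = p A + p B

/-- Conditional probability `p(A|B) = p(A∧B)/p(B)` (0 when `p(B) = 0`,
by the Lean convention on division by zero). -/
noncomputable def ProbFun.cond {α : Type} (P : ProbFun α) (A B : PFormula α) : ℝ :=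
  P.p (A.conj B) / P.p B

/-- Disjunction of a nonempty finite family `C 0 ∨ … ∨ C n`. -/
def disjFam {α : Type} : (n : ℕ) → (Fin (n + 1) → PFormula α) → PFormula α
  | 0, C => C 0
  | n + 1, C => (disjFam n (fun i => C i.castSucc)).disj (C (Fin.last (n + 1)))

theorem ProbFun.p_congr {α : Type} (P : ProbFun α) {A B : PFormula α}
    (h : ∀ v : DBValuation α, v.vT A ↔ v.vT B) : P.p A = P.p B :=
  le_antisymm (P.mono A B fun v => (h v).1) (P.mono B A fun v => (h v).2)

theorem cond_is_probability {α : Type} (P : ProbFun α) (B : PFormula α) (hB : 0 < P.p B) :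
    (∀ A : PFormula α, 0 ≤ P.cond A B ∧ P.cond A B ≤ 1) ∧
    (∀ A C : PFormula α, Entails A C → P.cond A B ≤ P.cond C B) ∧
    (∀ A C : PFormula α,
      P.cond (A.conj C) B + P.cond (A.disj C) B = P.cond A B + P.cond C B) ∧
    P.cond B B = 1 ∧
    (∀ A C : PFormula α, 0 < P.cond C B →
      P.cond (A.conj C) B / P.cond C B = P.cond A (B.conj C)) := by
  refine ⟨fun A => ⟨div_nonneg (P.nonneg _) hB.le, ?_⟩, fun A C h => ?_, fun A C => ?_, ?_,
    fun A C hC => ?_⟩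
  · refine (div_le_one hB).2 (P.mono _ _ fun v hv => ?_)
    exact ((v.conjT A B).1 hv).2
  · refine div_le_div_of_nonneg_right (P.mono _ _ fun v hv => ?_) hB.le
    rw [v.conjT] at hv ⊢
    exact ⟨h v hv.1, hv.2⟩
  · have hconj : P.p ((A.conj C).conj B) = P.p ((A.conj B).conj (C.conj B)) :=
      P.p_congr fun v => by simp only [v.conjT]; tauto
    have hdisj : P.p ((A.disj C).conj B) = P.p ((A.conj B).disj (C.conj B)) :=
      P.p_congr fun v => by simp only [v.conjT, v.disjT]; tauto
    simp only [ProbFun.cond]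
    rw [← add_div, ← add_div, hconj, hdisj, P.add]
  · have hBB : P.p (B.conj B) = P.p B := P.p_congr fun v => by simp only [v.conjT, and_self]
    rw [ProbFun.cond, hBB, div_self hB.ne']
  · have hnum : P.p ((A.conj C).conj B) = P.p (A.conj (B.conj C)) :=
      P.p_congr fun v => by simp only [v.conjT]; tauto
    have hden : P.p (C.conj B) = P.p (B.conj C) :=
      P.p_congr fun v => by simp only [v.conjT]; tauto
    simp only [ProbFun.cond]
    rw [div_div_div_cancel_right₀ hB.ne', hnum, hden]
end

section
/- (Theorem of Total Probability) Let p be a probability function, A a formula, and B₁, …, Bₙ formulas with p(Bᵢ ∧ Bⱼ) = 0 for all i ≠ j, p(B₁ ∨ … ∨ Bₙ) = 1, and p(Bᵢ) > 0 for each i. Then p(A) = Σᵢ p(A|Bᵢ)·p(Bᵢ). -/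
/-- Conjunction with a disjunction of pairwise probabilistically disjoint formulas is additive. -/
theorem ProbFun.p_conj_disjFam {α : Type} (P : ProbFun α) (n : ℕ) (A : PFormula α)
    (C : Fin (n + 1) → PFormula α)
    (hdisj : ∀ i j : Fin (n + 1), i ≠ j → P.p ((C i).conj (C j)) = 0) :
    P.p (A.conj (disjFam n C)) = ∑ i : Fin (n + 1), P.p (A.conj (C i)) := by
  induction n generalizing A with
  | zero => simp [disjFam]
  | succ n ih =>
    have hinit (X : PFormula α) := ih X (fun i => C i.castSucc)
      fun i j hij => hdisj _ _ fun h => hij (Fin.castSucc_injective _ h)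
    rw [Fin.sum_univ_castSucc, ← hinit A, disjFam]
    set D := disjFam n fun i => C i.castSucc
    set E := C (Fin.last (n + 1))
    have hED : P.p (E.conj D) = 0 := by
      rw [hinit E]
      exact Finset.sum_eq_zero fun i _ => hdisj _ _ (Fin.castSucc_lt_last i).ne'
    have hoverlap : P.p ((A.conj D).conj (A.conj E)) ≤ P.p (E.conj D) :=
      P.mono _ _ fun v h => by simp only [v.conjT] at h ⊢; tauto
    have hdistrib : P.p (A.conj (D.disj E)) = P.p ((A.conj D).disj (A.conj E)) := by
      apply le_antisymm <;> refine P.mono _ _ fun v h => ?_ <;>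
        simp only [v.conjT, v.disjT] at h ⊢ <;> tauto
    linarith [P.add (A.conj D) (A.conj E), P.nonneg ((A.conj D).conj (A.conj E))]

/-- Conjunction with a formula of probability one preserves probability. -/
theorem ProbFun.p_conj_of_eq_one {α : Type} (P : ProbFun α) (A D : PFormula α)
    (hD : P.p D = 1) : P.p (A.conj D) = P.p A := by
  have hle : P.p D ≤ P.p (A.disj D) := P.mono _ _ fun v h => (v.disjT A D).2 (Or.inr h)
  linarith [P.add A D, P.le_one (A.disj D)]

theorem total_probability {α : Type} (P : ProbFun α) (A : PFormula α)
    (n : ℕ) (B : Fin (n + 1) → PFormula α)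
    (hdisj : ∀ i j : Fin (n + 1), i ≠ j → P.p ((B i).conj (B j)) = 0)
    (hcover : P.p (disjFam n B) = 1)
    (hpos : ∀ i : Fin (n + 1), 0 < P.p (B i)) :
    P.p A = ∑ i : Fin (n + 1), P.cond A (B i) * P.p (B i) := by
  rw [← P.p_conj_of_eq_one A _ hcover, P.p_conj_disjFam n A B hdisj]
  exact Finset.sum_congr rfl fun i _ => (div_mul_cancel₀ _ (hpos i).ne').symm
end

section
/- (Characterization of coördinated conditionalization) Let p_x, p_y, p_z, p*_x be probability functions and B a formula with p_x(B)·p_y(B)·p_z(B) > 0. Then p*_x(A) = p_y(B|A)·p_x(A)/p_z(B) for all formulas A if and only if all of the following hold: (i) p*_x(B) = p_x(B)/p_z(B); (ii) for all A, p*_x(A) = 0 iff (p_x(A) = 0 or p_y(B|A) = 0); (iii) for all A and C with p*_x(A)·p*_x(C) > 0, (p_x(A)/p*_x(A))·p_y(B|A) = (p_x(C)/p*_x(C))·p_y(B|C). -/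
theorem ProbFun.p_conj_self {α : Type} (P : ProbFun α) (B : PFormula α) :
    P.p (B.conj B) = P.p B :=
  le_antisymm (P.mono _ _ fun v h => ((v.conjT B B).1 h).1)
    (P.mono _ _ fun v h => (v.conjT B B).2 ⟨h, h⟩)

theorem ProbFun.cond_self {α : Type} (P : ProbFun α) {B : PFormula α} (hB : P.p B ≠ 0) :
    P.cond B B = 1 := by
  rw [ProbFun.cond, P.p_conj_self, div_self hB]

theorem coordinated_conditionalization_characterization {α : Type}
    (px py pz pxs : ProbFun α) (B : PFormula α)
    (hpos : 0 < px.p B * py.p B * pz.p B) :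
    (∀ A : PFormula α, pxs.p A = py.cond B A * px.p A / pz.p B) ↔
      (pxs.p B = px.p B / pz.p B ∧
       (∀ A : PFormula α, pxs.p A = 0 ↔ (px.p A = 0 ∨ py.cond B A = 0)) ∧
       (∀ A C : PFormula α, 0 < pxs.p A * pxs.p C →
         (px.p A / pxs.p A) * py.cond B A = (px.p C / pxs.p C) * py.cond B C)) := by
  have hx : 0 < px.p B := (px.nonneg B).lt_of_ne' fun h => by simp [h] at hpos
  have hy : 0 < py.p B := (py.nonneg B).lt_of_ne' fun h => by simp [h] at hpos
  have hz : 0 < pz.p B := (pz.nonneg B).lt_of_ne' fun h => by simp [h] at hpos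
  have hB : py.cond B B = 1 := py.cond_self hy.ne'
  constructor
  · intro h
    have key : ∀ A, pxs.p A ≠ 0 → px.p A / pxs.p A * py.cond B A = pz.p B := by
      intro A hA
      rw [div_mul_eq_mul_div, div_eq_iff hA, h A]
      field_simp
    refine ⟨by rw [h B, hB, one_mul], fun A => ?_, fun A C hAC => ?_⟩
    · simp [h A, hz.ne', or_comm]
    · rw [key A (left_ne_zero_of_mul hAC.ne'), key C (right_ne_zero_of_mul hAC.ne')]
  · rintro ⟨hsB, hzero, hratio⟩ A
    by_cases hA : pxs.p A = 0
    · rcases (hzero A).1 hA with h | h <;> simp [hA, h]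
    · have hsB_pos : 0 < pxs.p B := hsB ▸ div_pos hx hz
      have h := hratio A B (mul_pos ((pxs.nonneg A).lt_of_ne' hA) hsB_pos)
      rw [hB, mul_one, hsB, div_div_cancel₀ hx.ne', div_mul_eq_mul_div, div_eq_iff hA] at h
      rw [eq_div_iff hz.ne', mul_comm (py.cond B A), h, mul_comm]
end

section
/- (Characterization of coördinated Bayesian conditionalization) Let p_y, p_z, p*_x be probability functions and B₁, B₂ formulas such that {B₁, B₂} behaves as a partition under p_z (p_z(B₁∧B₂) = 0 and p_z(B₁∨B₂) = 1), p_y(B₁) > 0, and p_y(B₁∧B₂) = p_z(B₁∧B₂). Then p*_x(A) = p_y(A|B₁) for all formulas A if and only if all of the following hold: (i) p*_x(B₁) = 1 and p*_x(B₂) = 0; (ii) for all A, p*_x(A|B₁) = p_y(A|B₁); (iii) {B₁, B₂} behaves as a partition under p*_x. -/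
theorem Entails.conj_left {α : Type} (A B : PFormula α) : Entails (A.conj B) A :=
  fun v h => ((v.conjT A B).1 h).1

theorem Entails.conj_right {α : Type} (A B : PFormula α) : Entails (A.conj B) B :=
  fun v h => ((v.conjT A B).1 h).2

theorem Entails.conj_intro {α : Type} {A B C : PFormula α} (hB : Entails A B)
    (hC : Entails A C) : Entails A (B.conj C) :=
  fun v h => (v.conjT B C).2 ⟨hB v h, hC v h⟩

theorem Entails.disj_left {α : Type} (A B : PFormula α) : Entails A (A.disj B) :=
  fun v h => (v.disjT A B).2 (Or.inl h)

theorem Entails.disj_right {α : Type} (A B : PFormula α) : Entails B (A.disj B) :=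
  fun v h => (v.disjT A B).2 (Or.inr h)

namespace ProbFun

variable {α : Type} (P : ProbFun α)

theorem p_eq_of_entails {A B : PFormula α} (hAB : Entails A B) (hBA : Entails B A) :
    P.p A = P.p B :=
  le_antisymm (P.mono _ _ hAB) (P.mono _ _ hBA)

theorem p_conj_comm (A B : PFormula α) : P.p (A.conj B) = P.p (B.conj A) :=
  P.p_eq_of_entails (.conj_intro (.conj_right A B) (.conj_left A B))
    (.conj_intro (.conj_right B A) (.conj_left B A))

theorem p_conj_self_s18 (A : PFormula α) : P.p (A.conj A) = P.p A :=
  P.p_eq_of_entails (.conj_left A A) (.conj_intro (fun _ h => h) (fun _ h => h))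

theorem p_disj_eq_one_of_left {A : PFormula α} (h : P.p A = 1) (B : PFormula α) :
    P.p (A.disj B) = 1 :=
  le_antisymm (P.le_one _) (h.symm.le.trans (P.mono _ _ (.disj_left A B)))

theorem p_disj_eq_one_of_right {B : PFormula α} (h : P.p B = 1) (A : PFormula α) :
    P.p (A.disj B) = 1 :=
  le_antisymm (P.le_one _) (h.symm.le.trans (P.mono _ _ (.disj_right A B)))

theorem p_conj_eq_zero_of_right {B : PFormula α} (h : P.p B = 0) (A : PFormula α) :
    P.p (A.conj B) = 0 :=
  le_antisymm ((P.mono _ _ (.conj_right A B)).trans h.le) (P.nonneg _)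

/-- Conditioning on a formula of probability one changes nothing. -/
theorem cond_of_p_eq_one {B : PFormula α} (h : P.p B = 1) (A : PFormula α) :
    P.cond A B = P.p A := by
  have hadd := P.add A B
  rw [P.p_disj_eq_one_of_right h A, h] at hadd
  rw [cond, h, div_one]
  linarith

end ProbFun

theorem coordinated_bayesian_conditionalization {α : Type}
    (py pz pxs : ProbFun α) (B1 B2 : PFormula α)
    (hpart1 : pz.p (B1.conj B2) = 0) (hpart2 : pz.p (B1.disj B2) = 1)
    (hy : 0 < py.p B1) (hyz : py.p (B1.conj B2) = pz.p (B1.conj B2)) :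
    (∀ A : PFormula α, pxs.p A = py.cond A B1) ↔
      ((pxs.p B1 = 1 ∧ pxs.p B2 = 0) ∧
       (∀ A : PFormula α, pxs.cond A B1 = py.cond A B1) ∧
       (pxs.p (B1.conj B2) = 0 ∧ pxs.p (B1.disj B2) = 1)) := by
  constructor
  · intro h
    have h1 : pxs.p B1 = 1 := by
      rw [h, ProbFun.cond, py.p_conj_self_s18, div_self hy.ne']
    have h2 : pxs.p B2 = 0 := by
      rw [h, ProbFun.cond, py.p_conj_comm, hyz, hpart1, zero_div]
    refine ⟨⟨h1, h2⟩, fun A => ?_, pxs.p_conj_eq_zero_of_right h2 B1,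
      pxs.p_disj_eq_one_of_left h1 B2⟩
    rw [pxs.cond_of_p_eq_one h1, h]
  · rintro ⟨⟨h1, -⟩, hcond, -⟩ A
    rw [← hcond, pxs.cond_of_p_eq_one h1]
end
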